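/- Let k be a field, d ≥ 1, R = k[x₀,…,x_d]/(x₀,…,x_d)², and fix a₀,…,a_d ∈ k not all zero. Let L = k ⊕ R/(a₀x₀+⋯+a_d x_d) (as R-modules, where R acts on the factor k through R → k). Let π: R² → L be a surjective R-module homomorphism. Then ker π has k-dimension d+2, and is spanned over k by the elements (ℓ,0), (0,ℓ), and (v·x_i, −u·x_i) for i = 0,…,d, where ℓ = ∑ a_i x_i and (u,v) ∈ k² ∖ {0} is determined by π. -/

import Mathlib

noncomputable section
set_option synthInstance.maxHeartbeats 1000000
set_option maxHeartbeats 2000000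

/-- The ideal `(x₀,…,x_d)` of the polynomial ring. -/
def mIdeal (k : Type*) [Field k] (n : ℕ) : Ideal (MvPolynomial (Fin n) k) :=
  Ideal.span (Set.range MvPolynomial.X)

/-- The Artinian local ring `R = k[x₀,…,x_d]/(x₀,…,x_d)²`. -/
abbrev SqZeroRing (k : Type*) [Field k] (n : ℕ) :=
  MvPolynomial (Fin n) k ⧸ (mIdeal k n ^ 2)

/-- The class of `xᵢ` in `R`. -/
def xbar (k : Type*) [Field k] (n : ℕ) (i : Fin n) : SqZeroRing k n :=
  Ideal.Quotient.mk (mIdeal k n ^ 2) (MvPolynomial.X i)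

/-- The maximal ideal `(x₀,…,x_d)` of `R`. -/
def maxIdeal (k : Type*) [Field k] (n : ℕ) : Ideal (SqZeroRing k n) :=
  Ideal.span (Set.range (xbar k n))

/-- The element `ℓ = a₀x₀ + ⋯ + a_d x_d` of `R`. -/
def ellElt (k : Type*) [Field k] (d : ℕ) (a : Fin (d + 1) → k) : SqZeroRing k (d + 1) :=
  ∑ i, algebraMap k (SqZeroRing k (d + 1)) (a i) * xbar k (d + 1) i

/-- The `R`-module `L = k ⊕ R/(a₀x₀+⋯+a_d x_d)`, where `R` acts on `k ≅ R/(x₀,…,x_d)`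
through the residue map. -/
abbrev Lmod (k : Type*) [Field k] (d : ℕ) (a : Fin (d + 1) → k) :=
  (SqZeroRing k (d + 1) ⧸ maxIdeal k (d + 1)) ×
    (SqZeroRing k (d + 1) ⧸ Ideal.span {ellElt k d a})

/-- The `k`-linear inclusion of the span of the variables into `R`. -/
def linForm (k : Type*) [Field k] (n : ℕ) : (Fin n → k) →ₗ[k] SqZeroRing k n :=
  Fintype.linearCombination k (xbar k n)

theorem linForm_apply (k : Type*) [Field k] (n : ℕ) (c : Fin n → k) :
    linForm k n c = ∑ i, c i • xbar k n i :=
  Fintype.linearCombination_apply k (xbar k n) c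

theorem xbar_mul_xbar (k : Type*) [Field k] (n : ℕ) (i j : Fin n) :
    xbar k n i * xbar k n j = 0 := by
  rw [xbar, xbar, ← map_mul, Ideal.Quotient.eq_zero_iff_mem, pow_two]
  exact Ideal.mul_mem_mul (Ideal.subset_span ⟨i, rfl⟩) (Ideal.subset_span ⟨j, rfl⟩)

theorem linForm_mul_linForm (k : Type*) [Field k] (n : ℕ) (b c : Fin n → k) :
    linForm k n b * linForm k n c = 0 := by
  simp [linForm_apply, Finset.sum_mul_sum, xbar_mul_xbar]

theorem linForm_single (k : Type*) [Field k] (n : ℕ) (i : Fin n) :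
    linForm k n (Pi.single i 1) = xbar k n i := by
  simp [linForm, Fintype.linearCombination_apply_single]

/-- The coordinates of an element of `R` with respect to `1, x₀, …, x_d`, packaged as a
map to the trivial square-zero extension of `k`. -/
def toTrivSqZeroExt (k : Type*) [Field k] (n : ℕ) :
    SqZeroRing k n →ₐ[k] TrivSqZeroExt k (Fin n → k) :=
  Ideal.Quotient.liftₐ (mIdeal k n ^ 2)
    (MvPolynomial.aeval fun i => TrivSqZeroExt.inr (Pi.single i 1)) (by
      intro p hp
      have hle : mIdeal k n ^ 2 ≤ RingHom.ker (MvPolynomial.aeval (R := k)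
          fun i : Fin n => (TrivSqZeroExt.inr (Pi.single i 1) : TrivSqZeroExt k (Fin n → k))) := by
        rw [pow_two, mIdeal, Ideal.span_mul_span', Ideal.span_le]
        rintro _ ⟨_, ⟨i, rfl⟩, _, ⟨j, rfl⟩, rfl⟩
        simp [RingHom.mem_ker]
      exact hle hp)

theorem toTrivSqZeroExt_xbar (k : Type*) [Field k] (n : ℕ) (i : Fin n) :
    toTrivSqZeroExt k n (xbar k n i) = TrivSqZeroExt.inr (Pi.single i 1) :=
  MvPolynomial.aeval_X _ i

theorem toTrivSqZeroExt_linForm (k : Type*) [Field k] (n : ℕ) (c : Fin n → k) :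
    toTrivSqZeroExt k n (linForm k n c) = TrivSqZeroExt.inr c := by
  simp only [linForm_apply, map_sum, map_smul, toTrivSqZeroExt_xbar, ← TrivSqZeroExt.inr_smul]
  rw [← TrivSqZeroExt.inr_sum]
  congr 1
  ext j
  simp [Finset.sum_apply, Pi.single_apply]

theorem linForm_injective (k : Type*) [Field k] (n : ℕ) :
    Function.Injective (linForm k n) := fun b c h =>
  TrivSqZeroExt.inr_injective (R := k) <| by
    rw [← toTrivSqZeroExt_linForm, ← toTrivSqZeroExt_linForm, h]

/-- The residue map `R → k`. -/
def residueHom (k : Type*) [Field k] (n : ℕ) : SqZeroRing k n →ₐ[k] k :=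
  (TrivSqZeroExt.fstHom k k (Fin n → k)).comp (toTrivSqZeroExt k n)

theorem residueHom_linForm (k : Type*) [Field k] (n : ℕ) (c : Fin n → k) :
    residueHom k n (linForm k n c) = 0 := by
  simp [residueHom, toTrivSqZeroExt_linForm]

theorem exists_eq_algebraMap_add_linForm (k : Type*) [Field k] (n : ℕ) (r : SqZeroRing k n) :
    ∃ c, r = algebraMap k _ (residueHom k n r) + linForm k n c := by
  suffices h : ∃ (b : k) (c : Fin n → k), r = algebraMap k _ b + linForm k n c by
    obtain ⟨b, c, rfl⟩ := h
    exact ⟨c, by simp [residueHom_linForm]⟩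
  obtain ⟨p, rfl⟩ := Ideal.Quotient.mk_surjective r
  induction p using MvPolynomial.induction_on with
  | C b => exact ⟨b, 0, by rw [map_zero, add_zero]; rfl⟩
  | add p q hp hq =>
    obtain ⟨b, c, h⟩ := hp
    obtain ⟨b', c', h'⟩ := hq
    exact ⟨b + b', c + c', by rw [map_add, h, h', map_add, map_add]; abel⟩
  | mul_X p i hp =>
    obtain ⟨b, c, h⟩ := hp
    refine ⟨0, b • Pi.single i 1, ?_⟩
    have hx : Ideal.Quotient.mk (mIdeal k n ^ 2) (MvPolynomial.X i) =
      linForm k n (Pi.single i 1) := (linForm_single k n i).symm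
    rw [map_mul, h, hx, add_mul, linForm_mul_linForm, map_smul, map_zero, Algebra.smul_def]
    ring

theorem mul_linForm (k : Type*) [Field k] (n : ℕ) (r : SqZeroRing k n) (c : Fin n → k) :
    r * linForm k n c = residueHom k n r • linForm k n c := by
  obtain ⟨b, hb⟩ := exists_eq_algebraMap_add_linForm k n r
  rw [Algebra.smul_def]
  conv_lhs => rw [hb]
  rw [add_mul, linForm_mul_linForm, add_zero]

theorem mem_maxIdeal_iff (k : Type*) [Field k] (n : ℕ) (r : SqZeroRing k n) :
    r ∈ maxIdeal k n ↔ residueHom k n r = 0 := by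
  constructor
  · intro hr
    have hle : maxIdeal k n ≤ RingHom.ker (residueHom k n) := by
      rw [maxIdeal, Ideal.span_le]
      rintro _ ⟨i, rfl⟩
      rw [← linForm_single]
      exact residueHom_linForm k n _
    exact hle hr
  · intro hr
    obtain ⟨c, hc⟩ := exists_eq_algebraMap_add_linForm k n r
    rw [hc, hr, map_zero, zero_add, linForm_apply]
    refine Ideal.sum_mem _ fun i _ => ?_
    rw [Algebra.smul_def]
    exact Ideal.mul_mem_left _ _ (Ideal.subset_span ⟨i, rfl⟩)

theorem ellElt_eq_linForm (k : Type*) [Field k] (d : ℕ) (a : Fin (d + 1) → k) :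
    ellElt k d a = linForm k (d + 1) a := by
  simp only [ellElt, linForm_apply, Algebra.smul_def]

theorem mem_span_ellElt_iff (k : Type*) [Field k] (d : ℕ) (a : Fin (d + 1) → k)
    (r : SqZeroRing k (d + 1)) :
    r ∈ Ideal.span {ellElt k d a} ↔ ∃ c : k, r = linForm k (d + 1) (c • a) := by
  rw [Ideal.mem_span_singleton', ellElt_eq_linForm]
  constructor
  · rintro ⟨s, rfl⟩
    exact ⟨residueHom k _ s, by rw [mul_linForm, map_smul]⟩
  · rintro ⟨c, rfl⟩
    exact ⟨algebraMap k _ c, by rw [map_smul, Algebra.smul_def]⟩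

/-- The kernel of a surjection `R² → L`, described through the residues `u, v` of the
second components of the images of the two generators. -/
theorem exists_mem_ker_iff (k : Type*) [Field k] (d : ℕ) (a : Fin (d + 1) → k)
    (π : (SqZeroRing k (d + 1) × SqZeroRing k (d + 1)) →ₗ[SqZeroRing k (d + 1)] Lmod k d a)
    (hπ : Function.Surjective π) :
    ∃ u v s t : k, s * u + t * v = 1 ∧ ∀ z, z ∈ LinearMap.ker π ↔
      ∃ (b b' : Fin (d + 1) → k) (c : k), z = (linForm k _ b, linForm k _ b') ∧
        u • b + v • b' = c • a := by
  obtain ⟨p, hp⟩ := Ideal.Quotient.mk_surjective (π (1, 0)).1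
  obtain ⟨α, hα⟩ := Ideal.Quotient.mk_surjective (π (1, 0)).2
  obtain ⟨q, hq⟩ := Ideal.Quotient.mk_surjective (π (0, 1)).1
  obtain ⟨β, hβ⟩ := Ideal.Quotient.mk_surjective (π (0, 1)).2
  have hval : ∀ f g, π (f, g) =
      (Ideal.Quotient.mk _ (f * p + g * q), Ideal.Quotient.mk _ (f * α + g * β)) := by
    intro f g
    have hfg : (f, g) = f • ((1 : SqZeroRing k (d + 1)), (0 : SqZeroRing k (d + 1))) +
        g • ((0 : SqZeroRing k (d + 1)), (1 : SqZeroRing k (d + 1))) := by simp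
    rw [hfg, map_add, map_smul, map_smul]
    ext
    · rw [Prod.fst_add, Prod.smul_fst, Prod.smul_fst, ← hp, ← hq]; rfl
    · rw [Prod.snd_add, Prod.smul_snd, Prod.smul_snd, ← hα, ← hβ]; rfl
  have hεspan : ∀ r ∈ Ideal.span {ellElt k d a}, residueHom k (d + 1) r = 0 := by
    intro r hr
    obtain ⟨c, rfl⟩ := (mem_span_ellElt_iff k d a r).1 hr
    exact residueHom_linForm k _ _
  have hsurj : ∀ y z : SqZeroRing k (d + 1), ∃ f g : k,
      f * residueHom k _ p + g * residueHom k _ q = residueHom k _ y ∧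
      f * residueHom k _ α + g * residueHom k _ β = residueHom k _ z := by
    intro y z
    obtain ⟨⟨f, g⟩, hfg⟩ := hπ (Ideal.Quotient.mk _ y, Ideal.Quotient.mk _ z)
    rw [hval, Prod.mk.injEq, Ideal.Quotient.eq, Ideal.Quotient.eq, mem_maxIdeal_iff] at hfg
    have h1 := hfg.1
    have h2 := hεspan _ hfg.2
    simp only [map_sub, map_add, map_mul, sub_eq_zero] at h1 h2
    exact ⟨_, _, h1, h2⟩
  obtain ⟨f₀, g₀, h₁, h₂⟩ := hsurj 1 0
  obtain ⟨s, t, h₃, h₄⟩ := hsurj 0 1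
  rw [map_one] at h₁ h₄
  rw [map_zero] at h₂ h₃
  refine ⟨residueHom k _ α, residueHom k _ β, s, t, h₄, ?_⟩
  rintro ⟨f, g⟩
  rw [LinearMap.mem_ker, hval, Prod.mk_eq_zero, Ideal.Quotient.eq_zero_iff_mem,
    Ideal.Quotient.eq_zero_iff_mem, mem_maxIdeal_iff]
  have hlin : ∀ b b', linForm k (d + 1) b * α + linForm k (d + 1) b' * β =
      linForm k (d + 1) (residueHom k _ α • b + residueHom k _ β • b') := by
    intro b b'
    rw [mul_comm, mul_linForm, mul_comm, mul_linForm, map_add, map_smul, map_smul]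
  constructor
  · rintro ⟨h₅, h₆⟩
    have h₇ := hεspan _ h₆
    simp only [map_add, map_mul] at h₅ h₇
    have hf : residueHom k _ f = 0 := by grind
    have hg : residueHom k _ g = 0 := by grind
    obtain ⟨b, hb⟩ := exists_eq_algebraMap_add_linForm k _ f
    obtain ⟨b', hb'⟩ := exists_eq_algebraMap_add_linForm k _ g
    rw [hf, map_zero, zero_add] at hb
    rw [hg, map_zero, zero_add] at hb'
    obtain ⟨c, hc⟩ := (mem_span_ellElt_iff k d a _).1 h₆
    rw [hb, hb', hlin] at hc
    exact ⟨b, b', c, by rw [hb, hb'], linForm_injective k _ hc⟩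
  · rintro ⟨b, b', c, h, hc⟩
    obtain ⟨rfl, rfl⟩ := Prod.mk.inj h
    refine ⟨by simp [residueHom_linForm], (mem_span_ellElt_iff k d a _).2 ⟨c, ?_⟩⟩
    rw [hlin, hc]

/-- For any surjective `R`-module map `π : R² → L = k ⊕ R/(∑ aᵢxᵢ)` (with `a ≠ 0`),
the kernel of `π` has `k`-dimension `d + 2` and is spanned over `k` by `(ℓ,0)`,
`(0,ℓ)` and the `(v·xᵢ, −u·xᵢ)`, for a pair `(u,v) ∈ k² ∖ {0}` determined by `π`. -/
theorem stmt7 (k : Type*) [Field k] (d : ℕ) (hd : 1 ≤ d)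
    (a : Fin (d + 1) → k) (ha : a ≠ 0)
    (π : (SqZeroRing k (d + 1) × SqZeroRing k (d + 1)) →ₗ[SqZeroRing k (d + 1)] Lmod k d a)
    (hπ : Function.Surjective π) :
    Module.finrank k ((LinearMap.ker π).restrictScalars k) = d + 2 ∧
    ∃ u v : k, ¬(u = 0 ∧ v = 0) ∧
      (LinearMap.ker π).restrictScalars k =
        Submodule.span k
          ({(ellElt k d a, 0), (0, ellElt k d a)} ∪
            Set.range (fun i : Fin (d + 1) =>
              (algebraMap k (SqZeroRing k (d + 1)) v * xbar k (d + 1) i,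
               -(algebraMap k (SqZeroRing k (d + 1)) u * xbar k (d + 1) i)))) := by
  obtain ⟨u, v, s, t, hst, hker⟩ := exists_mem_ker_iff k d a π hπ
  let B : (k × (Fin (d + 1) → k)) →ₗ[k] (Fin (d + 1) → k) × (Fin (d + 1) → k) :=
    LinearMap.coprod ((s • LinearMap.toSpanSingleton k _ a).prod
        (t • LinearMap.toSpanSingleton k _ a))
      ((v • LinearMap.id).prod (-(u • LinearMap.id)))
  let T := ((linForm k (d + 1)).prodMap (linForm k (d + 1))).comp B
  have hB : ∀ c b, B (c, b) = (s • c • a + v • b, t • c • a - u • b) := by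
    intro c b
    simp [B, sub_eq_add_neg]
  have hT : ∀ c b, T (c, b) =
      (linForm k _ (s • c • a + v • b), linForm k _ (t • c • a - u • b)) := by
    intro c b
    rw [LinearMap.comp_apply, hB]; rfl
  have hTinj : Function.Injective T := by
    have hBinj : Function.Injective B := by
      rw [← LinearMap.ker_eq_bot, LinearMap.ker_eq_bot']
      rintro ⟨c, b⟩ h
      rw [hB, Prod.mk_eq_zero] at h
      obtain ⟨h₁, h₂⟩ := h
      have hca : c • a = 0 := by
        calc c • a = (s * u + t * v) • c • a := by rw [hst, one_smul]
          _ = u • (s • c • a + v • b) + v • (t • c • a - u • b) := by module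
          _ = 0 := by rw [h₁, h₂, smul_zero, smul_zero, add_zero]
      have hc : c = 0 := (smul_eq_zero.1 hca).resolve_right ha
      have hb : b = 0 := by
        calc b = (s * u + t * v) • b := by rw [hst, one_smul]
          _ = t • (s • c • a + v • b) - s • (t • c • a - u • b) := by module
          _ = 0 := by rw [h₁, h₂, smul_zero, smul_zero, sub_zero]
      rw [hc, hb]; rfl
    exact ((linForm_injective k _).prodMap (linForm_injective k _)).comp hBinj
  have hrange : (LinearMap.ker π).restrictScalars k = LinearMap.range T := by
    ext z
    rw [Submodule.restrictScalars_mem, hker, LinearMap.mem_range]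
    constructor
    · rintro ⟨b, b', c, rfl, hc⟩
      refine ⟨(c, t • b - s • b'), ?_⟩
      rw [hT, ← hc]
      congr 2
      · calc _ = (s * u + t * v) • b := by module
          _ = b := by rw [hst, one_smul]
      · calc _ = (s * u + t * v) • b' := by module
          _ = b' := by rw [hst, one_smul]
    · rintro ⟨⟨c, b⟩, rfl⟩
      refine ⟨_, _, c, hT c b, ?_⟩
      calc _ = (s * u + t * v) • c • a := by module
        _ = c • a := by rw [hst, one_smul]
  refine ⟨?_, u, v, ?_, le_antisymm ?_ ?_⟩
  · rw [hrange, LinearMap.finrank_range_of_inj hTinj]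
    simp
    omega
  · rintro ⟨rfl, rfl⟩
    simp at hst
  · rw [hrange]
    rintro _ ⟨⟨c, b⟩, rfl⟩
    have hdecomp : T (c, b) = (s * c) • (ellElt k d a, (0 : SqZeroRing k (d + 1))) +
        (t * c) • ((0 : SqZeroRing k (d + 1)), ellElt k d a) +
        ∑ i, b i • (algebraMap k (SqZeroRing k (d + 1)) v * xbar k (d + 1) i,
          -(algebraMap k (SqZeroRing k (d + 1)) u * xbar k (d + 1) i)) := by
      rw [hT, ellElt_eq_linForm]
      ext
      · simp only [← Algebra.smul_def, Prod.fst_add, Prod.smul_fst, Prod.fst_sum, map_add,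
          map_smul, linForm_apply k _ b, Finset.smul_sum, smul_smul, mul_comm v, smul_zero,
          add_zero]
      · simp only [← Algebra.smul_def, Prod.snd_add, Prod.smul_snd, Prod.snd_sum, map_add,
          map_neg, map_smul, linForm_apply k _ b, Finset.smul_sum, smul_smul, mul_comm u, smul_zero,
          zero_add, smul_neg, Finset.sum_neg_distrib, sub_eq_add_neg]
    rw [hdecomp]
    refine add_mem (add_mem ?_ ?_) (sum_mem fun i _ => ?_)
    · exact Submodule.smul_mem _ _ (Submodule.subset_span (by simp))
    · exact Submodule.smul_mem _ _ (Submodule.subset_span (by simp))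
    · exact Submodule.smul_mem _ _ (Submodule.subset_span (Or.inr ⟨i, rfl⟩))
  · rw [Submodule.span_le]
    rintro _ ((rfl | rfl) | ⟨i, rfl⟩)
    · exact (hker _).2 ⟨a, 0, u, by rw [map_zero, ellElt_eq_linForm], by simp⟩
    · exact (hker _).2 ⟨0, a, v, by rw [map_zero, ellElt_eq_linForm], by simp⟩
    · refine (hker _).2 ⟨v • Pi.single i 1, -(u • Pi.single i 1), 0, ?_, by module⟩
      rw [map_neg, map_smul, map_smul, linForm_single, Algebra.smul_def, Algebra.smul_def]
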